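/- arXiv:math/0703434 — 2 statements merged into one kernel-verified Lean document; each statement's English description precedes it below -/
import Mathlib

section
/- Markov renewal theorem with infinite mean: let (A(n))_{n∈ℕ} and L be kernels on ℝ and set G_{x,·} := ∑_{n∈ℕ} A_{x,·}(n). Assume: (i) there is c > 0 such that A_{x,F}(n) ≤ c L_{x,F}/n² for all n, x, F; (ii) n² A_{x,F}(n) → L_{x,F} as n → ∞ for every x ∈ ℝ and every bounded Borel set F; (iii) there exists β > 1 such that ((1−βG)^{−1} ∘ L ∘ (1−βG)^{−1})_{x,F} < ∞ for every x ∈ ℝ and every bounded Borel set F. Then for every x ∈ ℝ and every bounded Borel set F, n² ∑_{k=0}^{∞} A^{*k}_{x,F}(n) → ((1−G)^{−1} ∘ L ∘ (1−G)^{−1})_{x,F} as n → ∞. -/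
open MeasureTheory Filter Topology Set
open scoped ENNReal NNReal BigOperators

noncomputable section

/-- composition of kernels: `(A ∘ B)_{x,F} = ∫ B_{z,F} A_{x,dz}` -/
def kcomp (A B : ℝ → Measure ℝ) (x : ℝ) : Measure ℝ := (A x).bind B

/-- `k`-fold composition of a kernel with itself, `A^{∘0}_{x,·} = δ_x` -/
def kpow (A : ℝ → Measure ℝ) : ℕ → ℝ → Measure ℝ
  | 0 => fun x => Measure.dirac x
  | k + 1 => kcomp (kpow A k) A

/-- convolution of families of kernels: `(A * B)_{x,·}(n) = ∑_{m=0}^n (A(m) ∘ B(n-m))_{x,·}` -/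
def kconv (A B : ℕ → ℝ → Measure ℝ) (n : ℕ) (x : ℝ) : Measure ℝ :=
  ∑ m ∈ Finset.range (n + 1), ((A m x).bind (B (n - m)))

/-- `k`-fold convolution of a family of kernels with itself,
`A^{*0}_{x,·}(n) = δ_x 1_{(n = 0)}` -/
def kconvpow (A : ℕ → ℝ → Measure ℝ) : ℕ → ℕ → ℝ → Measure ℝ
  | 0 => fun n x => if n = 0 then Measure.dirac x else 0
  | k + 1 => kconv (kconvpow A k) A

/-- `(1 - A)^{-1}_{x,·} = ∑_{k≥0} A^{∘k}_{x,·}` -/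
def kinv (A : ℝ → Measure ℝ) (x : ℝ) : Measure ℝ := Measure.sum fun k : ℕ => kpow A k x

/-- `G_{x,·} = ∑_{n ∈ ℕ} A_{x,·}(n)` -/
def kG (A : ℕ → ℝ → Measure ℝ) (x : ℝ) : Measure ℝ := Measure.sum fun n : ℕ => A n x

/-- Dominated convergence for series of extended nonnegative numbers. -/
theorem tendsto_tsum_of_dominated_ennreal {u : ℕ → ℕ → ℝ≥0∞} {v bound : ℕ → ℝ≥0∞}
    (h_bound : ∀ n i, u n i ≤ bound i) (h_fin : ∑' i, bound i ≠ ⊤)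
    (h_lim : ∀ i, Tendsto (fun n => u n i) atTop (𝓝 (v i))) :
    Tendsto (fun n => ∑' i, u n i) atTop (𝓝 (∑' i, v i)) := by
  simp only [← lintegral_count] at h_fin ⊢
  exact tendsto_lintegral_of_dominated_convergence bound (fun _ => measurable_of_countable _)
    (fun n => .of_forall (h_bound n)) h_fin (.of_forall h_lim)

/-- Convergence of dominated integrals can be checked on the terms of a series. -/
theorem tendsto_mul_lintegral_tsum {α : Type*} [MeasurableSpace α] {μ : ℕ → Measure α}
    {ν : Measure α} {w : ℕ → ℝ≥0∞} {C : ℝ≥0∞} (hC : C ≠ ⊤) {f : ℕ → α → ℝ≥0∞}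
    (hf : ∀ i, Measurable (f i))
    (hle : ∀ n i, w n * ∫⁻ x, f i x ∂(μ n) ≤ C * ∫⁻ x, f i x ∂ν)
    (hfin : ∫⁻ x, ∑' i, f i x ∂ν ≠ ⊤)
    (hlim : ∀ i, Tendsto (fun n => w n * ∫⁻ x, f i x ∂(μ n)) atTop (𝓝 (∫⁻ x, f i x ∂ν))) :
    Tendsto (fun n => w n * ∫⁻ x, ∑' i, f i x ∂(μ n)) atTop (𝓝 (∫⁻ x, ∑' i, f i x ∂ν)) := by
  have hsum (ρ : Measure α) : ∫⁻ x, ∑' i, f i x ∂ρ = ∑' i, ∫⁻ x, f i x ∂ρ :=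
    lintegral_tsum fun i => (hf i).aemeasurable
  simp only [hsum, ← ENNReal.tsum_mul_left] at hfin ⊢
  refine tendsto_tsum_of_dominated_ennreal (bound := fun i => C * ∫⁻ x, f i x ∂ν) hle ?_ hlim
  rw [ENNReal.tsum_mul_left]
  exact ENNReal.mul_ne_top hC hfin

/-- Setwise convergence on bounded sets of dominated measures extends to integrable functions. -/
theorem tendsto_mul_lintegral_of_tendsto_bounded {μ : ℕ → Measure ℝ} {ν : Measure ℝ}
    {w : ℕ → ℝ≥0∞} {C : ℝ≥0∞} (hC : C ≠ ⊤)
    (hle : ∀ n (f : ℝ → ℝ≥0∞), w n * ∫⁻ x, f x ∂(μ n) ≤ C * ∫⁻ x, f x ∂ν)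
    (hlim : ∀ F : Set ℝ, MeasurableSet F → Bornology.IsBounded F →
      Tendsto (fun n => w n * μ n F) atTop (𝓝 (ν F)))
    {f : ℝ → ℝ≥0∞} (hf : Measurable f) (hfin : ∫⁻ x, f x ∂ν ≠ ⊤) :
    Tendsto (fun n => w n * ∫⁻ x, f x ∂(μ n)) atTop (𝓝 (∫⁻ x, f x ∂ν)) := by
  let s : ℕ → ℝ → ℝ≥0∞ := fun i x => (SimpleFunc.eapproxDiff f i x : ℝ≥0∞)
  let B : ℕ → Set ℝ := fun j => {x | ⌊|x|⌋₊ = j}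
  have hs (i : ℕ) : Measurable (s i) := (SimpleFunc.eapproxDiff f i).measurable.coe_nnreal_ennreal
  have hB (j : ℕ) : MeasurableSet (B j) :=
    (Nat.measurable_floor.comp measurable_norm) (measurableSet_singleton j)
  have hBb (j : ℕ) : Bornology.IsBounded (B j) := by
    refine (Metric.isBounded_ball (x := (0 : ℝ)) (r := j + 1)).subset fun x hx => ?_
    have := Nat.lt_floor_add_one |x|
    rw [show ⌊|x|⌋₊ = j from hx] at this
    simpa using this
  have hsf (x : ℝ) : ∑' i, s i x = f x := SimpleFunc.tsum_eapproxDiff f hf x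
  have hBs (i : ℕ) (x : ℝ) : ∑' j, (B j).indicator (s i) x = s i x := by
    rw [tsum_eq_single ⌊|x|⌋₊]
    · exact indicator_of_mem (show x ∈ B ⌊|x|⌋₊ from rfl) (s i)
    · intro j hj
      exact indicator_of_notMem (fun h : x ∈ B j => hj (Eq.symm h)) (s i)
  have hsfin (i : ℕ) : ∫⁻ x, s i x ∂ν ≠ ⊤ :=
    ne_top_of_le_ne_top hfin (lintegral_mono fun x => hsf x ▸ ENNReal.le_tsum i)
  have hpiece (i j : ℕ) : Tendsto (fun n => w n * ∫⁻ x, (B j).indicator (s i) x ∂(μ n)) atTop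
      (𝓝 (∫⁻ x, (B j).indicator (s i) x ∂ν)) := by
    let g : SimpleFunc ℝ ℝ≥0∞ := (SimpleFunc.eapproxDiff f i).map (fun r : ℝ≥0 => (r : ℝ≥0∞))
    have key (ρ : Measure ℝ) : ∫⁻ x, (B j).indicator (s i) x ∂ρ =
        ∑ y ∈ g.range, y * ρ (g ⁻¹' {y} ∩ B j) := by
      rw [lintegral_indicator (hB j)]
      change ∫⁻ x in B j, g x ∂ρ = _
      rw [SimpleFunc.lintegral_eq_lintegral, SimpleFunc.lintegral]
      exact Finset.sum_congr rfl fun y _ => by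
        rw [Measure.restrict_apply (g.measurableSet_fiber y)]
    simp only [key, Finset.mul_sum]
    refine tendsto_finsetSum _ fun y hy => ?_
    have hy_top : y ≠ ⊤ := by
      obtain ⟨x, rfl⟩ := SimpleFunc.mem_range.1 hy
      exact ENNReal.coe_ne_top
    have := ENNReal.Tendsto.const_mul (a := y) (hlim (g ⁻¹' {y} ∩ B j)
      ((g.measurableSet_fiber y).inter (hB j)) ((hBb j).subset inter_subset_right))
      (Or.inr hy_top)
    simpa only [mul_left_comm] using this
  have hsimple (i : ℕ) :
      Tendsto (fun n => w n * ∫⁻ x, s i x ∂(μ n)) atTop (𝓝 (∫⁻ x, s i x ∂ν)) := by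
    have := tendsto_mul_lintegral_tsum hC (fun j => (hs i).indicator (hB j))
      (fun n j => hle n _) (by simpa only [hBs] using hsfin i) (hpiece i)
    simpa only [hBs] using this
  have := tendsto_mul_lintegral_tsum hC hs (fun n i => hle n _)
    (by simpa only [hsf] using hfin) hsimple
  simpa only [hsf] using this

theorem tendsto_shift_sq_mul {u : ℕ → ℝ≥0∞} {s : ℝ≥0∞}
    (h : Tendsto (fun n : ℕ => (n : ℝ≥0∞) ^ 2 * u n) atTop (𝓝 s)) (j : ℕ) :
    Tendsto (fun n : ℕ => (n : ℝ≥0∞) ^ 2 * u (n - j)) atTop (𝓝 s) := by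
  rw [← tendsto_add_atTop_iff_nat j]
  have hratio : Tendsto (fun n : ℕ => ENNReal.ofReal ((1 + (j : ℝ) / n) ^ 2)) atTop (𝓝 1) := by
    have : Tendsto (fun n : ℕ => (1 + (j : ℝ) / n) ^ 2) atTop (𝓝 ((1 + 0) ^ 2)) :=
      (tendsto_const_nhds.add (tendsto_const_div_atTop_nhds_zero_nat (j : ℝ))).pow 2
    simpa using ENNReal.tendsto_ofReal this
  have hmul := ENNReal.Tendsto.mul hratio (Or.inl one_ne_zero) h (Or.inr ENNReal.one_ne_top)
  rw [one_mul] at hmul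
  refine hmul.congr' ?_
  filter_upwards [eventually_ge_atTop 1] with n hn
  have hn0 : (n : ℝ) ≠ 0 := by positivity
  rw [← mul_assoc, Nat.add_sub_cancel]
  congr 1
  rw [← ENNReal.ofReal_natCast n, ← ENNReal.ofReal_natCast (n + j),
    ← ENNReal.ofReal_pow (by positivity), ← ENNReal.ofReal_pow (by positivity),
    ← ENNReal.ofReal_mul (by positivity), ← mul_pow]
  congr 2
  push_cast
  field_simp

theorem tsum_sum_range_eq_tsum_tsum (g : ℕ → ℕ → ℝ≥0∞) :
    ∑' n, ∑ m ∈ Finset.range (n + 1), g m (n - m) = ∑' m, ∑' j, g m j := by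
  simp_rw [← Finset.Nat.sum_antidiagonal_eq_sum_range_succ g]
  rw [← ENNReal.tsum_prod,
    ← Finset.HasAntidiagonal.sigmaAntidiagonalEquivProd.tsum_eq (fun p : ℕ × ℕ => g p.1 p.2),
    ENNReal.tsum_sigma']
  exact tsum_congr fun n => by
    rw [tsum_fintype, ← Finset.sum_coe_sort]
    rfl

/-- A Cauchy product is split according to which of the two indices is larger. -/
theorem sum_range_eq_tsum_add_tsum (g : ℕ → ℕ → ℝ≥0∞) (n : ℕ) :
    ∑ m ∈ Finset.range (n + 1), g m (n - m) =
      (∑' m, if 2 * m ≤ n then g m (n - m) else 0) +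
        ∑' j, if 2 * j < n then g (n - j) j else 0 := by
  rw [tsum_eq_sum (s := Finset.range (n + 1)), tsum_eq_sum (s := Finset.range (n + 1)),
    ← Finset.sum_range_reflect (fun j => if 2 * j < n then g (n - j) j else 0),
    ← Finset.sum_add_distrib]
  · refine Finset.sum_congr rfl fun m hm => ?_
    have hm' : m ≤ n := Nat.lt_succ_iff.1 (Finset.mem_range.1 hm)
    have h1 : n + 1 - 1 - m = n - m := by omega
    have h2 : n - (n - m) = m := by omega
    rw [h1, h2]
    by_cases h : 2 * m ≤ n
    · rw [if_pos h, if_neg (by omega), add_zero]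
    · rw [if_neg h, if_pos (by omega), zero_add]
  · intro j hj
    exact if_neg (by simp at hj; omega)
  · intro j hj
    exact if_neg (by simp at hj; omega)

theorem sq_le_four_mul_sq_sub {n m : ℕ} (h : 2 * m ≤ n) :
    (n : ℝ≥0∞) ^ 2 ≤ 4 * ((n - m : ℕ) : ℝ≥0∞) ^ 2 := by
  have : n ^ 2 ≤ 4 * (n - m) ^ 2 := by
    calc n ^ 2 ≤ (2 * (n - m)) ^ 2 := Nat.pow_le_pow_left (by omega) 2
      _ = 4 * (n - m) ^ 2 := by ring
  exact_mod_cast this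

/-- A weighted Cauchy–Schwarz inequality. -/
theorem mul_sq_le_of_le (k : ℕ) {n m : ℕ} (h : m ≤ n) :
    (k : ℝ≥0∞) * (n : ℝ≥0∞) ^ 2 ≤
      (k + 1) * (m : ℝ≥0∞) ^ 2 + k * (k + 1) * ((n - m : ℕ) : ℝ≥0∞) ^ 2 := by
  obtain ⟨j, rfl⟩ := Nat.exists_eq_add_of_le h
  rw [Nat.add_sub_cancel_left]
  have : k * (m + j) ^ 2 ≤ (k + 1) * m ^ 2 + k * (k + 1) * j ^ 2 := by
    zify
    nlinarith [sq_nonneg ((m : ℤ) - k * j)]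
  exact_mod_cast this

theorem measurable_kernel_apply {α : Type*} [MeasurableSpace α] {K : α → Measure ℝ}
    (hK : Measurable K) {s : Set ℝ} (hs : MeasurableSet s) : Measurable fun x => K x s :=
  (Measure.measurable_coe hs).comp hK

theorem measurable_const_smul_kernel (b : ℝ≥0∞) {K : ℝ → Measure ℝ} (hK : Measurable K) :
    Measurable fun z => b • K z := by
  refine Measure.measurable_of_measurable_coe _ fun s hs => ?_
  simpa using (measurable_kernel_apply hK hs).const_mul b

theorem measurable_measure_sum {α : Type*} [MeasurableSpace α] {K : ℕ → α → Measure ℝ}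
    (hK : ∀ n, Measurable (K n)) : Measurable fun x => Measure.sum fun n => K n x := by
  refine Measure.measurable_of_measurable_coe _ fun s hs => ?_
  simp only [Measure.sum_apply _ hs]
  exact Measurable.tsum fun n => measurable_kernel_apply (hK n) hs

theorem measurable_kG {A : ℕ → ℝ → Measure ℝ} (hA : ∀ n, Measurable (A n)) :
    Measurable (kG A) :=
  measurable_measure_sum hA

theorem measurable_kpow {K : ℝ → Measure ℝ} (hK : Measurable K) (k : ℕ) :
    Measurable (kpow K k) := by
  induction k with
  | zero => exact Measure.measurable_dirac
  | succ k ih => exact (Measure.measurable_bind' hK).comp ih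

theorem measurable_kinv {K : ℝ → Measure ℝ} (hK : Measurable K) : Measurable (kinv K) :=
  measurable_measure_sum (measurable_kpow hK)

theorem measurable_lintegral_kernel {K : ℝ → Measure ℝ} (hK : Measurable K) {f : ℝ → ℝ≥0∞}
    (hf : Measurable f) : Measurable fun z => ∫⁻ y, f y ∂(K z) :=
  (Measure.measurable_lintegral hf).comp hK

theorem lintegral_bind_kernel {μ : Measure ℝ} {K : ℝ → Measure ℝ} (hK : Measurable K)
    {f : ℝ → ℝ≥0∞} (hf : Measurable f) :
    ∫⁻ y, f y ∂(μ.bind K) = ∫⁻ z, ∫⁻ y, f y ∂(K z) ∂μ :=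
  Measure.lintegral_bind hK.aemeasurable hf.aemeasurable

theorem kpow_const_smul (b : ℝ≥0∞) {K : ℝ → Measure ℝ} (hK : Measurable K) (k : ℕ) (x : ℝ) :
    kpow (fun z => b • K z) k x = b ^ k • kpow K k x := by
  induction k with
  | zero => simp [kpow]
  | succ k ih =>
    ext s hs
    simp only [kpow, kcomp, ih]
    rw [Measure.bind_apply hs (measurable_const_smul_kernel b hK).aemeasurable, Measure.smul_apply,
      Measure.bind_apply hs hK.aemeasurable]
    simp only [Measure.smul_apply, smul_eq_mul, lintegral_smul_measure]
    rw [lintegral_const_mul _ (measurable_kernel_apply hK hs), pow_succ, mul_assoc]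

theorem lintegral_kconvpow_zero (A : ℕ → ℝ → Measure ℝ) (n : ℕ) (x : ℝ) {f : ℝ → ℝ≥0∞}
    (hf : Measurable f) :
    ∫⁻ y, f y ∂(kconvpow A 0 n x) = if n = 0 then f x else 0 := by
  by_cases h : n = 0 <;> simp [kconvpow, h, lintegral_dirac' _ hf]

theorem lintegral_kconvpow_succ {A : ℕ → ℝ → Measure ℝ} (hA : ∀ n, Measurable (A n))
    (k n : ℕ) (x : ℝ) {f : ℝ → ℝ≥0∞} (hf : Measurable f) :
    ∫⁻ y, f y ∂(kconvpow A (k + 1) n x) =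
      ∑ m ∈ Finset.range (n + 1), ∫⁻ z, ∫⁻ y, f y ∂(A (n - m) z) ∂(kconvpow A k m x) := by
  simp only [kconvpow, kconv, lintegral_finsetSum_measure, lintegral_bind_kernel (hA _) hf]

theorem lintegral_kG (A : ℕ → ℝ → Measure ℝ) (f : ℝ → ℝ≥0∞) (x : ℝ) :
    ∫⁻ y, f y ∂(kG A x) = ∑' j, ∫⁻ y, f y ∂(A j x) :=
  lintegral_sum_measure _ _

theorem lintegral_lintegral_kG {A : ℕ → ℝ → Measure ℝ} (hA : ∀ n, Measurable (A n))
    (μ : Measure ℝ) {f : ℝ → ℝ≥0∞} (hf : Measurable f) :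
    ∫⁻ z, ∫⁻ y, f y ∂(kG A z) ∂μ = ∑' j, ∫⁻ z, ∫⁻ y, f y ∂(A j z) ∂μ := by
  simp only [lintegral_kG]
  exact lintegral_tsum fun j => (measurable_lintegral_kernel (hA j) hf).aemeasurable

/-- Summing the convolution powers over time gives the powers of `G`. -/
theorem tsum_lintegral_kconvpow {A : ℕ → ℝ → Measure ℝ} (hA : ∀ n, Measurable (A n))
    (k : ℕ) (x : ℝ) {f : ℝ → ℝ≥0∞} (hf : Measurable f) :
    ∑' n, ∫⁻ y, f y ∂(kconvpow A k n x) = ∫⁻ y, f y ∂(kpow (kG A) k x) := by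
  induction k generalizing f with
  | zero => simp [lintegral_kconvpow_zero A _ x hf, kpow, lintegral_dirac' _ hf]
  | succ k ih =>
    simp only [lintegral_kconvpow_succ hA k _ x hf]
    rw [tsum_sum_range_eq_tsum_tsum
      fun m j => ∫⁻ z, ∫⁻ y, f y ∂(A j z) ∂(kconvpow A k m x)]
    simp only [← lintegral_lintegral_kG hA _ hf]
    rw [ih (measurable_lintegral_kernel (measurable_kG hA) hf), kpow, kcomp,
      lintegral_bind_kernel (measurable_kG hA) hf]

/-- The kernel `∑_{i + j = k - 1} G^{∘i} ∘ L ∘ G^{∘j}`, defined recursively in `k`. -/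
def oneBigJump (G L : ℝ → Measure ℝ) : ℕ → ℝ → Measure ℝ
  | 0 => fun _ => 0
  | k + 1 => fun x => (oneBigJump G L k x).bind G + (kpow G k x).bind L

theorem lintegral_oneBigJump_succ {G L : ℝ → Measure ℝ} (hG : Measurable G) (hL : Measurable L)
    (k : ℕ) (x : ℝ) {f : ℝ → ℝ≥0∞} (hf : Measurable f) :
    ∫⁻ y, f y ∂(oneBigJump G L (k + 1) x) =
      ∫⁻ z, ∫⁻ y, f y ∂(G z) ∂(oneBigJump G L k x) +
        ∫⁻ z, ∫⁻ y, f y ∂(L z) ∂(kpow G k x) := by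
  simp only [oneBigJump, lintegral_add_measure, lintegral_bind_kernel hG hf,
    lintegral_bind_kernel hL hf]

theorem lintegral_oneBigJump_succ_eq_sum {G L : ℝ → Measure ℝ} (hG : Measurable G)
    (hL : Measurable L) (k : ℕ) (x : ℝ) {f : ℝ → ℝ≥0∞} (hf : Measurable f) :
    ∫⁻ y, f y ∂(oneBigJump G L (k + 1) x) =
      ∑ i ∈ Finset.range (k + 1),
        ∫⁻ z, ∫⁻ w, ∫⁻ y, f y ∂(kpow G (k - i) w) ∂(L z) ∂(kpow G i x) := by
  induction k generalizing f with
  | zero =>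
    rw [lintegral_oneBigJump_succ hG hL 0 x hf]
    simp [oneBigJump, kpow, lintegral_dirac' _ hf]
  | succ k ih =>
    rw [lintegral_oneBigJump_succ hG hL (k + 1) x hf, ih (measurable_lintegral_kernel hG hf),
      Finset.sum_range_succ _ (k + 1)]
    congr 1
    · refine Finset.sum_congr rfl fun i hi => ?_
      rw [Nat.succ_sub (Nat.lt_succ_iff.1 (Finset.mem_range.1 hi))]
      simp only [kpow, kcomp, lintegral_bind_kernel hG hf]
    · simp [kpow, lintegral_dirac' _ hf]

/-- The uniform bound `n² A^{*k}(n) ≤ k C ∑_{i + j = k - 1} G^{∘i} ∘ L ∘ G^{∘j}`. -/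
theorem sq_mul_lintegral_kconvpow_le {A : ℕ → ℝ → Measure ℝ} {L : ℝ → Measure ℝ}
    (hA : ∀ n, Measurable (A n)) (hL : Measurable L) {C : ℝ≥0∞}
    (hle : ∀ (n : ℕ) x (f : ℝ → ℝ≥0∞),
      (n : ℝ≥0∞) ^ 2 * ∫⁻ y, f y ∂(A n x) ≤ C * ∫⁻ y, f y ∂(L x))
    (k n : ℕ) (x : ℝ) {f : ℝ → ℝ≥0∞} (hf : Measurable f) :
    (n : ℝ≥0∞) ^ 2 * ∫⁻ y, f y ∂(kconvpow A k n x) ≤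
      k * (C * ∫⁻ y, f y ∂(oneBigJump (kG A) L k x)) := by
  have hAf (j : ℕ) : Measurable fun z => ∫⁻ y, f y ∂(A j z) :=
    measurable_lintegral_kernel (hA j) hf
  have hLf : Measurable fun z => ∫⁻ y, f y ∂(L z) := measurable_lintegral_kernel hL hf
  induction k generalizing n f with
  | zero =>
    rw [lintegral_kconvpow_zero A n x hf]
    by_cases h : n = 0 <;> simp [h]
  | succ k ih =>
    rw [lintegral_oneBigJump_succ (measurable_kG hA) hL k x hf,
      lintegral_kconvpow_succ hA k n x hf]
    rcases Nat.eq_zero_or_pos k with rfl | hk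
    · simp only [lintegral_kconvpow_zero A _ x (hAf _), kpow, oneBigJump,
        lintegral_dirac' _ hLf]
      simpa using hle n x f
    have hk0 : (k : ℝ≥0∞) ≠ 0 := by exact_mod_cast hk.ne'
    rw [← ENNReal.mul_le_mul_iff_right hk0 (ENNReal.natCast_ne_top k)]
    set a : ℕ → ℕ → ℝ≥0∞ := fun m j => ∫⁻ z, ∫⁻ y, f y ∂(A j z) ∂(kconvpow A k m x) with ha
    have hfirst : ∑ m ∈ Finset.range (n + 1), (m : ℝ≥0∞) ^ 2 * a m (n - m) ≤
        k * (C * ∫⁻ z, ∫⁻ y, f y ∂(kG A z) ∂(oneBigJump (kG A) L k x)) := by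
      rw [lintegral_lintegral_kG hA _ hf, ← ENNReal.tsum_mul_left, ← ENNReal.tsum_mul_left]
      calc ∑ m ∈ Finset.range (n + 1), (m : ℝ≥0∞) ^ 2 * a m (n - m)
          ≤ ∑ m ∈ Finset.range (n + 1),
              k * (C * ∫⁻ z, ∫⁻ y, f y ∂(A (n - m) z) ∂(oneBigJump (kG A) L k x)) :=
            Finset.sum_le_sum fun m _ => ih m (hAf (n - m))
              (fun j => measurable_lintegral_kernel (hA j) (hAf (n - m)))
              (measurable_lintegral_kernel hL (hAf (n - m)))
        _ = ∑ j ∈ Finset.range (n + 1),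
              k * (C * ∫⁻ z, ∫⁻ y, f y ∂(A j z) ∂(oneBigJump (kG A) L k x)) := by
            simpa using Finset.sum_range_reflect (fun j =>
              k * (C * ∫⁻ z, ∫⁻ y, f y ∂(A j z) ∂(oneBigJump (kG A) L k x))) (n + 1)
        _ ≤ _ := ENNReal.sum_le_tsum _
    have hlast : ∑ m ∈ Finset.range (n + 1), ((n - m : ℕ) : ℝ≥0∞) ^ 2 * a m (n - m) ≤
        C * ∫⁻ z, ∫⁻ y, f y ∂(L z) ∂(kpow (kG A) k x) := by
      rw [← tsum_lintegral_kconvpow hA k x hLf, ← ENNReal.tsum_mul_left]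
      refine (Finset.sum_le_sum fun m _ => ?_).trans (ENNReal.sum_le_tsum (Finset.range (n + 1)))
      rw [ha, ← lintegral_const_mul _ (hAf _), ← lintegral_const_mul _ hLf]
      exact lintegral_mono fun z => hle _ z f
    calc (k : ℝ≥0∞) * ((n : ℝ≥0∞) ^ 2 * ∑ m ∈ Finset.range (n + 1), a m (n - m))
        = ∑ m ∈ Finset.range (n + 1), (k * (n : ℝ≥0∞) ^ 2) * a m (n - m) := by
          rw [← mul_assoc, Finset.mul_sum]
      _ ≤ ∑ m ∈ Finset.range (n + 1),
            ((k + 1) * (m : ℝ≥0∞) ^ 2 + k * (k + 1) * ((n - m : ℕ) : ℝ≥0∞) ^ 2) *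
              a m (n - m) :=
          Finset.sum_le_sum fun m hm => by
            gcongr
            exact mul_sq_le_of_le k (Nat.lt_succ_iff.1 (Finset.mem_range.1 hm))
      _ = (k + 1) * ∑ m ∈ Finset.range (n + 1), (m : ℝ≥0∞) ^ 2 * a m (n - m) +
            k * (k + 1) *
              ∑ m ∈ Finset.range (n + 1), ((n - m : ℕ) : ℝ≥0∞) ^ 2 * a m (n - m) := by
          simp only [add_mul, Finset.sum_add_distrib, Finset.mul_sum, mul_assoc]
      _ ≤ (k + 1) * (k * (C * ∫⁻ z, ∫⁻ y, f y ∂(kG A z) ∂(oneBigJump (kG A) L k x))) +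
            k * (k + 1) * (C * ∫⁻ z, ∫⁻ y, f y ∂(L z) ∂(kpow (kG A) k x)) := by
          gcongr
      _ = _ := by push_cast; ring

/-- For fixed `k`, `n² A^{*k}(n) → ∑_{i + j = k - 1} G^{∘i} ∘ L ∘ G^{∘j}`. -/
theorem tendsto_sq_mul_lintegral_kconvpow {A : ℕ → ℝ → Measure ℝ} {L : ℝ → Measure ℝ}
    (hA : ∀ n, Measurable (A n)) (hL : Measurable L) {C : ℝ≥0∞} (hC : C ≠ ⊤)
    (hle : ∀ (n : ℕ) x (f : ℝ → ℝ≥0∞),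
      (n : ℝ≥0∞) ^ 2 * ∫⁻ y, f y ∂(A n x) ≤ C * ∫⁻ y, f y ∂(L x))
    (hlim : ∀ x (f : ℝ → ℝ≥0∞), Measurable f → ∫⁻ y, f y ∂(L x) ≠ ⊤ →
      Tendsto (fun n : ℕ => (n : ℝ≥0∞) ^ 2 * ∫⁻ y, f y ∂(A n x)) atTop
        (𝓝 (∫⁻ y, f y ∂(L x))))
    (k : ℕ) (x : ℝ) {f : ℝ → ℝ≥0∞} (hf : Measurable f)
    (hfin : ∫⁻ y, f y ∂(oneBigJump (kG A) L k x) ≠ ⊤) :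
    Tendsto (fun n : ℕ => (n : ℝ≥0∞) ^ 2 * ∫⁻ y, f y ∂(kconvpow A k n x)) atTop
      (𝓝 (∫⁻ y, f y ∂(oneBigJump (kG A) L k x))) := by
  have h4 : (4 : ℝ≥0∞) ≠ ⊤ := by simp
  induction k generalizing f with
  | zero =>
    have h0 (n : ℕ) : (n : ℝ≥0∞) ^ 2 * ∫⁻ y, f y ∂(kconvpow A 0 n x) = 0 := by
      rw [lintegral_kconvpow_zero A n x hf]
      by_cases h : n = 0 <;> simp [h]
    simp [h0, oneBigJump]
  | succ k ih =>
    have hAf (j : ℕ) : Measurable fun z => ∫⁻ y, f y ∂(A j z) :=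
      measurable_lintegral_kernel (hA j) hf
    have hLf : Measurable fun z => ∫⁻ y, f y ∂(L z) := measurable_lintegral_kernel hL hf
    rw [lintegral_oneBigJump_succ (measurable_kG hA) hL k x hf] at hfin ⊢
    obtain ⟨hfinS, hfinG⟩ := ENNReal.add_ne_top.1 hfin
    rw [lintegral_lintegral_kG hA _ hf] at hfinS ⊢
    rw [← tsum_lintegral_kconvpow hA k x hLf] at hfinG ⊢
    set a : ℕ → ℕ → ℝ≥0∞ := fun m j => ∫⁻ z, ∫⁻ y, f y ∂(A j z) ∂(kconvpow A k m x) with ha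
    have hsplit (n : ℕ) : (n : ℝ≥0∞) ^ 2 * ∫⁻ y, f y ∂(kconvpow A (k + 1) n x) =
        (∑' j, if 2 * j < n then (n : ℝ≥0∞) ^ 2 * a (n - j) j else 0) +
          ∑' m, if 2 * m ≤ n then (n : ℝ≥0∞) ^ 2 * a m (n - m) else 0 := by
      rw [lintegral_kconvpow_succ hA k n x hf, sum_range_eq_tsum_add_tsum a, add_comm, mul_add,
        ← ENNReal.tsum_mul_left, ← ENNReal.tsum_mul_left]
      simp only [mul_ite, mul_zero]
    simp only [hsplit]
    refine Tendsto.add ?_ ?_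
    · refine tendsto_tsum_of_dominated_ennreal (bound := fun j =>
        4 * (k * (C * ∫⁻ z, ∫⁻ y, f y ∂(A j z) ∂(oneBigJump (kG A) L k x)))) ?_ ?_ ?_
      · intro n j
        split_ifs with h
        · calc (n : ℝ≥0∞) ^ 2 * a (n - j) j
              ≤ 4 * ((n - j : ℕ) : ℝ≥0∞) ^ 2 * a (n - j) j := by
                gcongr
                exact sq_le_four_mul_sq_sub h.le
            _ ≤ _ := by
                rw [mul_assoc]
                gcongr 4 * ?_
                exact sq_mul_lintegral_kconvpow_le hA hL hle k (n - j) x (hAf j)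
        · exact zero_le
      · simp only [ENNReal.tsum_mul_left]
        exact ENNReal.mul_ne_top h4
          (ENNReal.mul_ne_top (ENNReal.natCast_ne_top k) (ENNReal.mul_ne_top hC hfinS))
      · intro j
        refine (tendsto_shift_sq_mul
          (ih (hAf j) (ENNReal.ne_top_of_tsum_ne_top hfinS j)) j).congr' ?_
        filter_upwards [eventually_gt_atTop (2 * j)] with n hn
        rw [if_pos hn]
    · refine tendsto_tsum_of_dominated_ennreal (bound := fun m =>
        4 * (C * ∫⁻ z, ∫⁻ y, f y ∂(L z) ∂(kconvpow A k m x))) ?_ ?_ ?_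
      · intro n m
        split_ifs with h
        · calc (n : ℝ≥0∞) ^ 2 * a m (n - m)
              ≤ 4 * ((n - m : ℕ) : ℝ≥0∞) ^ 2 * a m (n - m) := by
                gcongr
                exact sq_le_four_mul_sq_sub h
            _ ≤ _ := by
                rw [mul_assoc]
                gcongr 4 * ?_
                rw [ha, ← lintegral_const_mul _ (hAf _), ← lintegral_const_mul _ hLf]
                exact lintegral_mono fun z => hle _ z f
        · exact zero_le
      · simp only [ENNReal.tsum_mul_left]
        exact ENNReal.mul_ne_top h4 (ENNReal.mul_ne_top hC hfinG)
      · intro m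
        have hfin_m : ∫⁻ z, ∫⁻ y, f y ∂(L z) ∂(kconvpow A k m x) ≠ ⊤ :=
          ENNReal.ne_top_of_tsum_ne_top hfinG m
        have hdom : Tendsto (fun n : ℕ => ∫⁻ z, (if 2 * m ≤ n then
            (n : ℝ≥0∞) ^ 2 * ∫⁻ y, f y ∂(A (n - m) z) else 0) ∂(kconvpow A k m x)) atTop
            (𝓝 (∫⁻ z, ∫⁻ y, f y ∂(L z) ∂(kconvpow A k m x))) := by
          refine tendsto_lintegral_of_dominated_convergence
            (fun z => 4 * (C * ∫⁻ y, f y ∂(L z))) ?_ ?_ ?_ ?_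
          · intro n
            split_ifs
            · exact (hAf _).const_mul _
            · exact measurable_const
          · refine fun n => .of_forall fun z => ?_
            dsimp only
            split_ifs with h
            · calc (n : ℝ≥0∞) ^ 2 * ∫⁻ y, f y ∂(A (n - m) z)
                  ≤ 4 * ((n - m : ℕ) : ℝ≥0∞) ^ 2 * ∫⁻ y, f y ∂(A (n - m) z) := by
                    gcongr
                    exact sq_le_four_mul_sq_sub h
                _ ≤ _ := by
                    rw [mul_assoc]
                    gcongr 4 * ?_
                    exact hle _ z f
            · exact zero_le
          · rw [lintegral_const_mul _ (hLf.const_mul _), lintegral_const_mul _ hLf]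
            exact ENNReal.mul_ne_top h4 (ENNReal.mul_ne_top hC hfin_m)
          · filter_upwards [ae_lt_top hLf hfin_m] with z hz
            refine (tendsto_shift_sq_mul (hlim z f hf hz.ne) m).congr' ?_
            filter_upwards [eventually_ge_atTop (2 * m)] with n hn
            rw [if_pos hn]
        refine hdom.congr fun n => ?_
        split_ifs
        · rw [lintegral_const_mul _ (hAf _)]
        · exact lintegral_zero

/-- The mass of `(1 - K)^{-1} ∘ L ∘ (1 - K)^{-1}` as a double series. -/
theorem kcomp_kinv_kinv_apply {K L : ℝ → Measure ℝ} (hK : Measurable K) (hL : Measurable L)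
    (x : ℝ) {F : Set ℝ} (hF : MeasurableSet F) :
    kcomp (kcomp (kinv K) L) (kinv K) x F =
      ∑' i, ∑' j, ∫⁻ z, ∫⁻ w, kpow K j w F ∂(L z) ∂(kpow K i x) := by
  have hj (j : ℕ) : Measurable fun w => kpow K j w F :=
    measurable_kernel_apply (measurable_kpow hK j) hF
  rw [kcomp, Measure.bind_apply hF (measurable_kinv hK).aemeasurable, kcomp,
    lintegral_bind_kernel hL (measurable_kernel_apply (measurable_kinv hK) hF),
    kinv, lintegral_sum_measure]
  refine tsum_congr fun i => ?_
  rw [← lintegral_tsum fun j => (measurable_lintegral_kernel hL (hj j)).aemeasurable]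
  refine lintegral_congr fun z => ?_
  rw [← lintegral_tsum fun j => (hj j).aemeasurable]
  exact lintegral_congr fun w => Measure.sum_apply _ hF

/-- Linear growth is dominated by geometric growth. -/
theorem exists_natCast_succ_le_mul_pow {β : ℝ} (hβ : 1 < β) :
    ∃ M : ℝ≥0∞, M ≠ ⊤ ∧ ∀ k : ℕ, ((k + 1 : ℕ) : ℝ≥0∞) ≤ M * ENNReal.ofReal β ^ k := by
  have hd : 0 < β - 1 := sub_pos.2 hβ
  refine ⟨ENNReal.ofReal (1 + (β - 1)⁻¹), ENNReal.ofReal_ne_top, fun k => ?_⟩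
  rw [← ENNReal.ofReal_natCast, ← ENNReal.ofReal_pow (by linarith),
    ← ENNReal.ofReal_mul (by positivity)]
  refine ENNReal.ofReal_le_ofReal ?_
  have hbern : 1 + k * (β - 1) ≤ β ^ k := by
    simpa using one_add_mul_le_pow (a := β - 1) (by linarith) k
  calc ((k + 1 : ℕ) : ℝ) ≤ (1 + (β - 1)⁻¹) * (1 + k * (β - 1)) := by
        have h1 : (β - 1)⁻¹ * (k * (β - 1)) = k := by field_simp
        have h2 : 0 < (β - 1)⁻¹ := inv_pos.2 hd
        have h3 : 0 ≤ k * (β - 1) := by positivity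
        push_cast
        linarith [add_mul 1 (β - 1)⁻¹ (1 + k * (β - 1)), mul_add (β - 1)⁻¹ 1 (k * (β - 1))]
    _ ≤ _ := by gcongr

/-- Equation (7.9): Markov renewal theorem with infinite mean:
`∑_{k≥0} A^{*k}_{x,F}(n) ∼ ((1−G)^{-1} ∘ L ∘ (1−G)^{-1})_{x,F} / n²` as `n → ∞`. -/
theorem markov_renewal_theorem_infinite_mean
    (A : ℕ → ℝ → Measure ℝ) (L : ℝ → Measure ℝ)
    (hA_meas : ∀ n, Measurable (A n)) (hL_meas : Measurable L)
    (hA_zero : ∀ x, A 0 x = 0)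
    (c : ℝ) (hc : 0 < c)
    (hbound : ∀ n : ℕ, 1 ≤ n → ∀ x : ℝ, ∀ F : Set ℝ, MeasurableSet F →
      A n x F ≤ ENNReal.ofReal (c / (n : ℝ) ^ 2) * L x F)
    (hlim : ∀ x : ℝ, ∀ F : Set ℝ, MeasurableSet F → Bornology.IsBounded F →
      Tendsto (fun n : ℕ => (n : ℝ≥0∞) ^ 2 * A n x F) atTop (𝓝 (L x F)))
    (β : ℝ) (hβ : 1 < β)
    (hfin : ∀ x : ℝ, ∀ F : Set ℝ, MeasurableSet F → Bornology.IsBounded F →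
      (kcomp (kcomp (kinv fun z => ENNReal.ofReal β • kG A z) L)
        (kinv fun z => ENNReal.ofReal β • kG A z)) x F < ⊤) :
    ∀ x : ℝ, ∀ F : Set ℝ, MeasurableSet F → Bornology.IsBounded F →
      Tendsto
        (fun n : ℕ => (n : ℝ≥0∞) ^ 2 * (Measure.sum fun k : ℕ => kconvpow A k n x) F)
        atTop (𝓝 ((kcomp (kcomp (kinv (kG A)) L) (kinv (kG A))) x F)) := by
  intro x F hF hFb
  have hG := measurable_kG hA_meas
  have hle (n : ℕ) (x : ℝ) (f : ℝ → ℝ≥0∞) :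
      (n : ℝ≥0∞) ^ 2 * ∫⁻ y, f y ∂(A n x) ≤ ENNReal.ofReal c * ∫⁻ y, f y ∂(L x) := by
    rcases Nat.eq_zero_or_pos n with rfl | hn
    · simp
    have hmeas : A n x ≤ ENNReal.ofReal (c / (n : ℝ) ^ 2) • L x :=
      Measure.le_iff.2 fun s hs => hbound n hn x s hs
    have hcancel : (n : ℝ≥0∞) ^ 2 * ENNReal.ofReal (c / (n : ℝ) ^ 2) = ENNReal.ofReal c := by
      rw [← ENNReal.ofReal_natCast, ← ENNReal.ofReal_pow (by positivity),
        ← ENNReal.ofReal_mul (by positivity), mul_div_cancel₀ _ (by positivity)]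
    calc (n : ℝ≥0∞) ^ 2 * ∫⁻ y, f y ∂(A n x)
        ≤ (n : ℝ≥0∞) ^ 2 * ∫⁻ y, f y ∂(ENNReal.ofReal (c / (n : ℝ) ^ 2) • L x) := by
          gcongr
      _ = ENNReal.ofReal c * ∫⁻ y, f y ∂(L x) := by
          rw [lintegral_smul_measure, smul_eq_mul, ← mul_assoc, hcancel]
  have hlim_fun (x : ℝ) (f : ℝ → ℝ≥0∞) (hf : Measurable f) (hfin : ∫⁻ y, f y ∂(L x) ≠ ⊤) :
      Tendsto (fun n : ℕ => (n : ℝ≥0∞) ^ 2 * ∫⁻ y, f y ∂(A n x)) atTop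
        (𝓝 (∫⁻ y, f y ∂(L x))) :=
    tendsto_mul_lintegral_of_tendsto_bounded ENNReal.ofReal_ne_top (fun n => hle n x)
      (hlim x) hf hfin
  set f : ℝ → ℝ≥0∞ := F.indicator 1
  have hf : Measurable f := measurable_one.indicator hF
  have hfF (μ : Measure ℝ) : ∫⁻ y, f y ∂μ = μ F := lintegral_indicator_one hF
  set D : ℕ → ℕ → ℝ≥0∞ := fun i j =>
    ∫⁻ z, ∫⁻ w, kpow (kG A) j w F ∂(L z) ∂(kpow (kG A) i x) with hD
  have hS (k : ℕ) : oneBigJump (kG A) L (k + 1) x F =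
      ∑ i ∈ Finset.range (k + 1), D i (k - i) := by
    rw [← hfF, lintegral_oneBigJump_succ_eq_sum hG hL_meas k x hf]
    simp only [hfF, hD]
  obtain ⟨M, hM, hMle⟩ := exists_natCast_succ_le_mul_pow hβ
  have hsum_fin : ∑' k, ∑ i ∈ Finset.range (k + 1),
      ENNReal.ofReal β ^ k * D i (k - i) ≠ ⊤ := by
    have hj (j : ℕ) : Measurable fun w => kpow (kG A) j w F :=
      measurable_kernel_apply (measurable_kpow hG j) hF
    have h := (hfin x F hF hFb).ne
    rw [kcomp_kinv_kinv_apply (measurable_const_smul_kernel _ hG) hL_meas x hF] at h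
    simp only [kpow_const_smul _ hG, Measure.smul_apply, smul_eq_mul, lintegral_smul_measure,
      lintegral_const_mul _ (hj _),
      lintegral_const_mul _ (measurable_lintegral_kernel hL_meas (hj _))] at h
    rw [← tsum_sum_range_eq_tsum_tsum] at h
    refine ne_of_eq_of_ne (tsum_congr fun k => Finset.sum_congr rfl fun i hi => ?_) h
    rw [← mul_assoc, ← pow_add, Nat.sub_add_cancel (Nat.lt_succ_iff.1 (Finset.mem_range.1 hi))]
  have hdom : ∑' k : ℕ, (k : ℝ≥0∞) * (ENNReal.ofReal c * oneBigJump (kG A) L k x F) ≠ ⊤ := by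
    rw [tsum_eq_zero_add' ENNReal.summable, Nat.cast_zero, zero_mul, zero_add]
    refine ne_top_of_le_ne_top
      (ENNReal.mul_ne_top (ENNReal.mul_ne_top hM (ENNReal.ofReal_ne_top (r := c))) hsum_fin) ?_
    rw [← ENNReal.tsum_mul_left]
    refine ENNReal.tsum_le_tsum fun k => ?_
    rw [hS, ← Finset.mul_sum]
    calc ((k + 1 : ℕ) : ℝ≥0∞) * (ENNReal.ofReal c * ∑ i ∈ Finset.range (k + 1), D i (k - i))
        ≤ M * ENNReal.ofReal β ^ k *
            (ENNReal.ofReal c * ∑ i ∈ Finset.range (k + 1), D i (k - i)) := by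
          gcongr
          exact hMle k
      _ = _ := by ring
  have hS_fin (k : ℕ) : oneBigJump (kG A) L k x F ≠ ⊤ := by
    rcases k with _ | k
    · simp [oneBigJump]
    intro htop
    have hterm := ENNReal.ne_top_of_tsum_ne_top hdom (k + 1)
    rw [htop, ENNReal.mul_top (by simpa using hc), ENNReal.mul_top (by simp)] at hterm
    exact hterm rfl
  have htarget : kcomp (kcomp (kinv (kG A)) L) (kinv (kG A)) x F =
      ∑' k, oneBigJump (kG A) L k x F := by
    rw [kcomp_kinv_kinv_apply hG hL_meas x hF, ← tsum_sum_range_eq_tsum_tsum D,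
      tsum_eq_zero_add' (f := fun k => oneBigJump (kG A) L k x F) ENNReal.summable]
    simp only [hS]
    simp only [oneBigJump, Measure.coe_zero, Pi.zero_apply, zero_add]
  rw [htarget]
  simp only [Measure.sum_apply _ hF, ← ENNReal.tsum_mul_left]
  refine tendsto_tsum_of_dominated_ennreal (fun n k => ?_) hdom fun k => ?_
  · simpa only [hfF] using sq_mul_lintegral_kconvpow_le hA_meas hL_meas hle k n x hf
  · simpa only [hfF] using tendsto_sq_mul_lintegral_kconvpow hA_meas hL_meas
      ENNReal.ofReal_ne_top hle hlim_fun k x hf (by simpa only [hfF] using hS_fin k)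
end
end

section
/- Convexity and derivative of the finite-volume free energy: for every a ∈ {p,w} and N ∈ ℕ, the function t ↦ log Z^a_{e^t, N} is convex and differentiable on ℝ, and for every ε > 0 its derivative at t = log ε equals E^a_{ε,N}[ℓ_N] − 1, where E^a_{ε,N} denotes expectation under P^a_{ε,N}. -/
open MeasureTheory Filter Topology Set
open scoped ENNReal NNReal BigOperators

noncomputable section

/-- The field `(φ_1, …, φ_{N-1})` extended to `ℤ` with zero boundary conditions
`φ_{-1} = φ_0 = φ_N = φ_{N+1} = 0`. -/
def fieldExt (N : ℕ) (φ : Fin (N - 1) → ℝ) (i : ℤ) : ℝ :=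
  if h : 0 < i ∧ i < (N : ℤ) then φ ⟨i.toNat - 1, by omega⟩ else 0

/-- `exp(−H_{[−1,N+1]}(φ))` with zero boundary conditions, where `E = exp(−V)` and
`H_{[a,b]}(φ) = ∑_{n=a+1}^{b-1} V(φ_{n+1} + φ_{n-1} - 2 φ_n)`. -/
def hamWeight (E : ℝ → ℝ) (N : ℕ) (φ : Fin (N - 1) → ℝ) : ℝ :=
  ∏ n ∈ Finset.Icc (0 : ℤ) (N : ℤ),
    E (fieldExt N φ (n + 1) + fieldExt N φ (n - 1) - 2 * fieldExt N φ n)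

/-- the single-site reference measure `ε δ_0(dx) + dx` of the pinning model -/
def pinFactor (ε : ℝ) : Measure ℝ :=
  ENNReal.ofReal ε • Measure.dirac 0 + volume

/-- the single-site reference measure `ε δ_0(dx) + dx 1_{(x ≥ 0)}` of the wetting model -/
def wetFactor (ε : ℝ) : Measure ℝ :=
  ENNReal.ofReal ε • Measure.dirac 0 + volume.restrict (Ici 0)

/-- the pinning partition function `Z^p_{ε,N}` -/
def Zpin (E : ℝ → ℝ) (ε : ℝ) (N : ℕ) : ℝ :=
  ∫ φ : Fin (N - 1) → ℝ, hamWeight E N φ ∂(Measure.pi fun _ => pinFactor ε)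

/-- the wetting partition function `Z^w_{ε,N}` -/
def Zwet (E : ℝ → ℝ) (ε : ℝ) (N : ℕ) : ℝ :=
  ∫ φ : Fin (N - 1) → ℝ, hamWeight E N φ ∂(Measure.pi fun _ => wetFactor ε)

/-- the pinning model `P^p_{ε,N}` -/
def Ppin (E : ℝ → ℝ) (ε : ℝ) (N : ℕ) : Measure (Fin (N - 1) → ℝ) :=
  (Measure.pi fun _ => pinFactor ε).withDensity
    fun φ => ENNReal.ofReal (hamWeight E N φ / Zpin E ε N)

/-- the wetting model `P^w_{ε,N}` -/
def Pwet (E : ℝ → ℝ) (ε : ℝ) (N : ℕ) : Measure (Fin (N - 1) → ℝ) :=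
  (Measure.pi fun _ => wetFactor ε).withDensity
    fun φ => ENNReal.ofReal (hamWeight E N φ / Zwet E ε N)

open scoped Classical in
/-- the contact number `ℓ_N(φ) = #{i ∈ {1,…,N} : φ_i = 0}` (with the convention `φ_N := 0`) -/
def contact (N : ℕ) (φ : Fin (N - 1) → ℝ) : ℕ :=
  ((Finset.Icc (1 : ℤ) (N : ℤ)).filter fun i => fieldExt N φ i = 0).card

/-- The single-site reference measure `ε δ_0 + lam`. -/
def siteMeasure (lam : Measure ℝ) (ε : ℝ) : Measure ℝ :=
  ENNReal.ofReal ε • Measure.dirac 0 + lam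

instance (lam : Measure ℝ) [SigmaFinite lam] (ε : ℝ) : SigmaFinite (siteMeasure lam ε) := by
  have : IsFiniteMeasure (ENNReal.ofReal ε • Measure.dirac (0 : ℝ)) :=
    Measure.smul_finite _ ENNReal.ofReal_ne_top
  unfold siteMeasure
  infer_instance

/-- The number of interior zeros of a field. -/
def zeroCount {m : ℕ} (φ : Fin m → ℝ) : ℝ :=
  ∑ i, ({0} : Set ℝ).indicator (fun _ => 1) (φ i)

lemma measurable_zeroCount {m : ℕ} : Measurable (zeroCount (m := m)) := by
  refine Finset.measurable_sum _ fun i _ => ?_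
  exact (measurable_const.indicator (measurableSet_singleton 0)).comp (measurable_pi_apply i)

lemma zeroCount_mem_Icc {m : ℕ} (φ : Fin m → ℝ) : zeroCount φ ∈ Icc (0 : ℝ) m := by
  constructor
  · exact Finset.sum_nonneg fun i _ => indicator_nonneg (fun _ _ => zero_le_one) _
  · calc zeroCount φ ≤ ∑ _i : Fin m, (1 : ℝ) :=
          Finset.sum_le_sum fun i _ => indicator_le_self' (fun _ _ => zero_le_one) _
      _ = m := by simp

lemma lintegral_pi_prod {m : ℕ} (μ : Fin m → Measure ℝ) [∀ i, SigmaFinite (μ i)]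
    (f : Fin m → ℝ → ℝ≥0∞) (hf : ∀ i, Measurable (f i)) :
    ∫⁻ φ, ∏ i, f i (φ i) ∂(Measure.pi μ) = ∏ i, ∫⁻ x, f i x ∂(μ i) := by
  induction m with
  | zero => simp
  | succ m ih =>
    have e := (measurePreserving_piFinSuccAbove μ 0).symm
    rw [← e.lintegral_comp_emb (MeasurableEquiv.measurableEmbedding _)]
    simp only [Fin.prod_univ_succ]
    have key : ∀ p : ℝ × (Fin m → ℝ),
        f 0 ((MeasurableEquiv.piFinSuccAbove (fun _ => ℝ) 0).symm p 0) *
          ∏ i : Fin m, f i.succ ((MeasurableEquiv.piFinSuccAbove (fun _ => ℝ) 0).symm p i.succ)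
        = f 0 p.1 * ∏ i : Fin m, f i.succ (p.2 i) := by
      intro p
      simp [MeasurableEquiv.piFinSuccAbove]
    simp_rw [key]
    rw [lintegral_prod_mul (g := fun ψ : Fin m → ℝ => ∏ i : Fin m, f i.succ (ψ i))
      (hf 0).aemeasurable (Finset.measurable_prod _ fun i _ =>
        (hf i.succ).comp (measurable_pi_apply i)).aemeasurable]
    congr 1
    exact ih _ _ fun i => hf _

lemma pi_withDensity {m : ℕ} (μ : Measure ℝ) [SigmaFinite μ] (f : ℝ → ℝ≥0∞) (hf : Measurable f)
    [SigmaFinite (μ.withDensity f)] :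
    Measure.pi (fun _ : Fin m => μ.withDensity f)
      = (Measure.pi fun _ => μ).withDensity fun φ => ∏ i, f (φ i) := by
  refine Measure.pi_eq fun s hs => ?_
  rw [withDensity_apply _ (MeasurableSet.univ_pi hs), Measure.restrict_pi_pi,
    lintegral_pi_prod _ _ fun _ => hf]
  exact Finset.prod_congr rfl fun i _ => (withDensity_apply _ (hs i)).symm

lemma siteMeasure_eq_withDensity (lam : Measure ℝ) (h0 : lam {0} = 0) (ε : ℝ) :
    siteMeasure lam ε = (siteMeasure lam 1).withDensity
      fun x => ENNReal.ofReal (if x = 0 then ε else 1) := by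
  have hm : Measurable fun x : ℝ => ENNReal.ofReal (if x = 0 then ε else 1) :=
    (Measurable.ite (measurableSet_singleton 0) measurable_const measurable_const).ennreal_ofReal
  have h1 : (lam.withDensity fun x => ENNReal.ofReal (if x = 0 then ε else 1)) = lam := by
    conv_rhs => rw [← withDensity_one (μ := lam)]
    refine withDensity_congr_ae ?_
    have : ∀ᵐ x ∂lam, x ≠ 0 := by
      rw [ae_iff]; simpa using h0
    filter_upwards [this] with x hx
    simp [hx]
  have h2 : ((Measure.dirac (0 : ℝ)).withDensity
      fun x => ENNReal.ofReal (if x = 0 then ε else 1)) = ENNReal.ofReal ε • Measure.dirac 0 := by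
    rw [dirac_withDensity' hm]
    simp
  simp only [siteMeasure, withDensity_add_measure, h1, ENNReal.ofReal_one, one_smul, h2]

lemma pi_siteMeasure_eq_withDensity (m : ℕ) (lam : Measure ℝ) [SigmaFinite lam] (h0 : lam {0} = 0)
    {ε : ℝ} (hε : 0 < ε) :
    Measure.pi (fun _ : Fin m => siteMeasure lam ε)
      = (Measure.pi fun _ => siteMeasure lam 1).withDensity
        fun φ => ENNReal.ofReal (Real.exp (Real.log ε * zeroCount φ)) := by
  have hm : Measurable fun x : ℝ => ENNReal.ofReal (if x = 0 then ε else 1) :=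
    (Measurable.ite (measurableSet_singleton 0) measurable_const measurable_const).ennreal_ofReal
  have hs := siteMeasure_eq_withDensity lam h0 ε
  have : SigmaFinite ((siteMeasure lam 1).withDensity
      fun x => ENNReal.ofReal (if x = 0 then ε else 1)) := hs ▸ inferInstance
  simp_rw [hs]
  rw [pi_withDensity _ _ hm]
  congr 1
  funext φ
  rw [zeroCount, Finset.mul_sum, Real.exp_sum,
    ENNReal.ofReal_prod_of_nonneg fun i _ => (Real.exp_pos _).le]
  refine Finset.prod_congr rfl fun i _ => ?_
  by_cases h : φ i = 0 <;> simp [h, Real.exp_log hε]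

lemma lintegral_triangular_prod_le {m : ℕ} (μ : Measure ℝ) [SigmaFinite μ] (g : ℝ → ℝ≥0∞)
    (hg : Measurable g) (C : ℝ≥0∞) (hC : ∀ c, ∫⁻ x, g (x + c) ∂μ ≤ C)
    (h : Fin m → (Fin m → ℝ) → ℝ) (hh : ∀ i, Measurable (h i))
    (hdep : ∀ i φ ψ, (∀ j < i, φ j = ψ j) → h i φ = h i ψ) :
    ∫⁻ φ, ∏ i, g (φ i + h i φ) ∂(Measure.pi fun _ => μ) ≤ C ^ m := by
  induction m with
  | zero => simp
  | succ m ih =>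
    have e := (measurePreserving_piFinSuccAbove (fun _ : Fin (m + 1) => μ) (Fin.last m)).symm
    have hsn : Measurable fun ψ : Fin m → ℝ => (Fin.snoc ψ 0 : Fin (m + 1) → ℝ) := by
      refine measurable_pi_lambda _ fun i => ?_
      induction i using Fin.lastCases with
      | last => simp
      | cast i => simpa using measurable_pi_apply i
    set k : Fin (m + 1) → (Fin m → ℝ) → ℝ := fun i ψ => h i (Fin.snoc ψ 0)
    have hkm : ∀ i, Measurable (k i) := fun i => (hh i).comp hsn
    have hval : ∀ p : ℝ × (Fin m → ℝ), ∀ i : Fin (m + 1),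
        h i ((MeasurableEquiv.piFinSuccAbove (fun _ => ℝ) (Fin.last m)).symm p) = k i p.2 := by
      intro p i
      refine hdep _ _ _ fun j hj => ?_
      have hj' : j ≠ Fin.last m := (hj.trans_le (Fin.le_last i)).ne
      obtain ⟨j, rfl⟩ := Fin.exists_castSucc_eq.2 hj'
      simp [MeasurableEquiv.piFinSuccAbove]
    rw [← e.lintegral_comp_emb (MeasurableEquiv.measurableEmbedding _)]
    have key : ∀ p : ℝ × (Fin m → ℝ),
        (∏ i, g ((MeasurableEquiv.piFinSuccAbove (fun _ => ℝ) (Fin.last m)).symm p i +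
          h i ((MeasurableEquiv.piFinSuccAbove (fun _ => ℝ) (Fin.last m)).symm p)))
        = (∏ i : Fin m, g (p.2 i + k i.castSucc p.2)) * g (p.1 + k (Fin.last m) p.2) := by
      intro p
      simp_rw [hval, Fin.prod_univ_castSucc]
      simp [MeasurableEquiv.piFinSuccAbove]
    simp_rw [key]
    rw [lintegral_prod_symm _ (by fun_prop)]
    calc _ ≤ ∫⁻ ψ, (∏ i : Fin m, g (ψ i + k i.castSucc ψ)) * C ∂(Measure.pi fun _ => μ) := by
          refine lintegral_mono fun ψ => ?_
          dsimp only
          rw [lintegral_const_mul _ (by fun_prop)]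
          gcongr
          exact hC _
      _ ≤ C ^ m * C := by
          rw [lintegral_mul_const _ (by fun_prop)]
          gcongr
          refine ih _ (fun i => hkm _) fun i φ ψ hij => ?_
          refine hdep _ _ _ fun j hj => ?_
          have hj' : j ≠ Fin.last m := (hj.trans_le (Fin.le_last _)).ne
          obtain ⟨j, rfl⟩ := Fin.exists_castSucc_eq.2 hj'
          simpa using hij j (by simpa using hj)
      _ = C ^ (m + 1) := (pow_succ _ _).symm

lemma measurable_fieldExt (N : ℕ) (i : ℤ) : Measurable fun φ => fieldExt N φ i := by
  unfold fieldExt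
  split_ifs
  · exact measurable_pi_apply _
  · exact measurable_const

lemma measurable_hamWeight {E : ℝ → ℝ} (hE : Continuous E) (N : ℕ) :
    Measurable (hamWeight E N) := by
  refine Finset.measurable_prod _ fun n _ => hE.measurable.comp ?_
  exact ((measurable_fieldExt N _).add (measurable_fieldExt N _)).sub
    ((measurable_fieldExt N _).const_mul 2)

lemma fieldExt_succ {m : ℕ} (φ : Fin m → ℝ) (i : Fin m) :
    fieldExt (m + 1) φ ((i : ℤ) + 1) = φ i := by
  have hi := i.2
  unfold fieldExt
  rw [dif_pos (by push_cast; omega)]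
  congr 1

lemma contact_succ {m : ℕ} (φ : Fin m → ℝ) :
    (contact (m + 1) φ : ℝ) = zeroCount φ + 1 := by
  classical
  have himg : Finset.Icc (1 : ℤ) ((m + 1 : ℕ) : ℤ)
      = (Finset.range (m + 1)).image fun n : ℕ => (n : ℤ) + 1 := by
    ext x
    simp only [Finset.mem_Icc, Finset.mem_image, Finset.mem_range]
    constructor
    · intro hx
      exact ⟨(x - 1).toNat, by omega, by omega⟩
    · rintro ⟨n, hn, rfl⟩
      push_cast
      omega
  have hlast : fieldExt (m + 1) φ ((m : ℤ) + 1) = 0 := by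
    unfold fieldExt
    rw [dif_neg (by push_cast; omega)]
  rw [contact, Finset.card_filter, himg,
    Finset.sum_image (fun a _ b _ hab => by simpa using hab), Finset.sum_range_succ, hlast,
    Finset.sum_range fun n : ℕ => if fieldExt (m + 1) φ ((n : ℤ) + 1) = 0 then 1 else 0]
  simp only [fieldExt_succ, zeroCount]
  push_cast
  simp [Set.indicator_apply]

lemma hamWeight_succ_le {E : ℝ → ℝ} (hE : ∀ x, 0 ≤ E x) {M : ℝ} (hM : ∀ x, E x ≤ M) {m : ℕ}
    (φ : Fin m → ℝ) :
    hamWeight E (m + 1) φ ≤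
      (∏ i : Fin m, E (φ i + (fieldExt (m + 1) φ ((i : ℤ) - 1) - 2 * fieldExt (m + 1) φ i)))
        * (M * M) := by
  have himg : Finset.Icc (0 : ℤ) ((m + 1 : ℕ) : ℤ)
      = (Finset.range (m + 2)).image fun n : ℕ => (n : ℤ) := by
    ext x
    simp only [Finset.mem_Icc, Finset.mem_image, Finset.mem_range]
    constructor
    · intro hx
      exact ⟨x.toNat, by omega, by omega⟩
    · rintro ⟨n, hn, rfl⟩
      push_cast
      omega
  have hM0 : 0 ≤ M := (hE 0).trans (hM 0)
  rw [hamWeight, himg, Finset.prod_image (fun a _ b _ hab => by simpa using hab),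
    Finset.prod_range_succ, Finset.prod_range_succ, mul_assoc,
    Finset.prod_range fun n : ℕ => E (fieldExt (m + 1) φ ((n : ℤ) + 1)
      + fieldExt (m + 1) φ ((n : ℤ) - 1) - 2 * fieldExt (m + 1) φ n)]
  simp only [fieldExt_succ, add_sub_assoc]
  exact mul_le_mul_of_nonneg_left (mul_le_mul (hM _) (hM _) (hE _) hM0)
    (Finset.prod_nonneg fun _ _ => hE _)

lemma hamWeight_nonneg {E : ℝ → ℝ} (hE : ∀ x, 0 ≤ E x) (N : ℕ) (φ : Fin (N - 1) → ℝ) :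
    0 ≤ hamWeight E N φ :=
  Finset.prod_nonneg fun _ _ => hE _

lemma fieldExt_congr_of_lt {m : ℕ} {φ ψ : Fin m → ℝ} {i : Fin m} (h : ∀ j < i, φ j = ψ j)
    {n : ℤ} (hn : n ≤ i) : fieldExt (m + 1) φ n = fieldExt (m + 1) ψ n := by
  unfold fieldExt
  split_ifs with hpos
  · exact h _ (by rw [Fin.lt_def]; simp; omega)
  · rfl

lemma lintegral_hamWeight_lt_top {E : ℝ → ℝ} (hE : ∀ x, 0 ≤ E x) (hE_cont : Continuous E)
    {M : ℝ} (hM : ∀ x, E x ≤ M) (hE_int : Integrable E) (lam : Measure ℝ) [SigmaFinite lam]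
    (hle : lam ≤ volume) (m : ℕ) :
    ∫⁻ φ : Fin m → ℝ, ENNReal.ofReal (hamWeight E (m + 1) φ)
      ∂(Measure.pi fun _ => siteMeasure lam 1) < ∞ := by
  set g : ℝ → ℝ≥0∞ := fun x => ENNReal.ofReal (E x)
  have hg : Measurable g := hE_cont.measurable.ennreal_ofReal
  set C : ℝ≥0∞ := ENNReal.ofReal M + ∫⁻ x, g x
  have hCtop : C < ∞ :=
    ENNReal.add_lt_top.2 ⟨ENNReal.ofReal_lt_top, hE_int.lintegral_lt_top⟩
  have hC : ∀ c, ∫⁻ x, g (x + c) ∂(siteMeasure lam 1) ≤ C := by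
    intro c
    rw [siteMeasure, lintegral_add_measure, ENNReal.ofReal_one, one_smul, lintegral_dirac]
    refine add_le_add (ENNReal.ofReal_le_ofReal (hM _)) ?_
    calc ∫⁻ x, g (x + c) ∂lam ≤ ∫⁻ x, g (x + c) := lintegral_mono' hle le_rfl
      _ = ∫⁻ x, g x := lintegral_add_right_eq_self g c
  have hprod := lintegral_triangular_prod_le (m := m) (siteMeasure lam 1) g hg C hC
    (fun i φ => fieldExt (m + 1) φ ((i : ℤ) - 1) - 2 * fieldExt (m + 1) φ i)
    (fun i => (measurable_fieldExt (m + 1) _).sub ((measurable_fieldExt (m + 1) _).const_mul 2))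
    (fun i φ ψ h => by
      simp only [fieldExt_congr_of_lt h (n := (i : ℤ) - 1) (by omega),
        fieldExt_congr_of_lt h (n := (i : ℤ)) le_rfl])
  calc _ ≤ ∫⁻ φ : Fin m → ℝ, (∏ i, g (φ i + (fieldExt (m + 1) φ ((i : ℤ) - 1)
          - 2 * fieldExt (m + 1) φ i))) * ENNReal.ofReal (M * M)
          ∂(Measure.pi fun _ => siteMeasure lam 1) := by
        refine lintegral_mono fun φ => ?_
        refine (ENNReal.ofReal_le_ofReal (hamWeight_succ_le hE hM φ)).trans_eq ?_
        rw [ENNReal.ofReal_mul (Finset.prod_nonneg fun _ _ => hE _),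
          ENNReal.ofReal_prod_of_nonneg fun _ _ => hE _]
    _ ≤ C ^ m * ENNReal.ofReal (M * M) := by
        rw [lintegral_mul_const' _ _ ENNReal.ofReal_ne_top]
        gcongr
    _ < ∞ := ENNReal.mul_lt_top (ENNReal.pow_lt_top hCtop) ENNReal.ofReal_lt_top

lemma hamWeight_zero (E : ℝ → ℝ) (m : ℕ) :
    hamWeight E (m + 1) (0 : Fin m → ℝ) = E 0 ^ (m + 2) := by
  have : ∀ i, fieldExt (m + 1) (0 : Fin m → ℝ) i = 0 := fun i => by simp [fieldExt]
  simp only [hamWeight, this]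
  simp
  congr 1

/-- The unnormalized Gibbs measure with pinning strength one. -/
def gibbsMeasure (E : ℝ → ℝ) (lam : Measure ℝ) (m : ℕ) : Measure (Fin m → ℝ) :=
  (Measure.pi fun _ => siteMeasure lam 1).withDensity
    fun φ : Fin m → ℝ => ENNReal.ofReal (hamWeight E (m + 1) φ)

lemma gibbsMeasure_ne_zero {E : ℝ → ℝ} (hE_pos : 0 < E 0)
    (lam : Measure ℝ) [SigmaFinite lam] (m : ℕ) : gibbsMeasure E lam m ≠ 0 := by
  intro h
  have h0 : gibbsMeasure E lam m {0} = 0 := by rw [h]; rfl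
  have hsingle : (Measure.pi fun _ : Fin m => siteMeasure lam 1) {0} ≠ 0 := by
    rw [← Set.univ_pi_singleton, Measure.pi_pi]
    refine Finset.prod_ne_zero_iff.2 fun i _ => ?_
    simp [siteMeasure]
  rw [gibbsMeasure, withDensity_apply _ (measurableSet_singleton _), Measure.restrict_singleton,
    lintegral_smul_measure, lintegral_dirac, hamWeight_zero, smul_eq_mul, mul_eq_zero] at h0
  refine h0.elim hsingle fun h1 => ?_
  exact (ENNReal.ofReal_pos.2 (pow_pos hE_pos (m + 2))).ne' h1

lemma convexOn_cgf {Ω : Type*} [MeasurableSpace Ω] {X : Ω → ℝ} {μ : Measure Ω}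
    (h : ∀ t, t ∈ interior (ProbabilityTheory.integrableExpSet X μ)) :
    ConvexOn ℝ univ (ProbabilityTheory.cgf X μ) := by
  have hd : Differentiable ℝ (ProbabilityTheory.cgf X μ) := fun t =>
    (ProbabilityTheory.analyticAt_cgf (h t)).differentiableAt
  have hd2 : Differentiable ℝ (deriv (ProbabilityTheory.cgf X μ)) := fun t =>
    (ProbabilityTheory.analyticAt_cgf (h t)).deriv.differentiableAt
  refine convexOn_univ_of_deriv2_nonneg hd hd2 fun t => ?_
  rw [← iteratedDeriv_eq_iterate, ProbabilityTheory.iteratedDeriv_two_cgf_eq_integral (h t)]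
  exact div_nonneg (integral_nonneg fun ω => mul_nonneg (sq_nonneg _) (Real.exp_pos _).le)
    ProbabilityTheory.mgf_nonneg

lemma integral_gibbsMeasure {E : ℝ → ℝ} (hE : ∀ x, 0 ≤ E x) (hE_cont : Continuous E)
    (lam : Measure ℝ) (m : ℕ) (f : (Fin m → ℝ) → ℝ) :
    ∫ φ, f φ ∂(gibbsMeasure E lam m)
      = ∫ φ : Fin m → ℝ, hamWeight E (m + 1) φ * f φ
        ∂(Measure.pi fun _ => siteMeasure lam 1) := by
  have hW : Measurable fun φ : Fin m → ℝ => hamWeight E (m + 1) φ :=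
    measurable_hamWeight hE_cont (m + 1)
  rw [gibbsMeasure, integral_withDensity_eq_integral_toReal_smul
    hW.ennreal_ofReal (Eventually.of_forall fun _ => ENNReal.ofReal_lt_top)]
  simp only [ENNReal.toReal_ofReal (hamWeight_nonneg hE (m + 1) _), smul_eq_mul]

lemma integral_pi_siteMeasure (m : ℕ) (lam : Measure ℝ) [SigmaFinite lam] (h0 : lam {0} = 0)
    {ε : ℝ} (hε : 0 < ε) (f : (Fin m → ℝ) → ℝ) :
    ∫ φ, f φ ∂(Measure.pi fun _ : Fin m => siteMeasure lam ε)
      = ∫ φ, Real.exp (Real.log ε * zeroCount φ) * f φ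
        ∂(Measure.pi fun _ => siteMeasure lam 1) := by
  rw [pi_siteMeasure_eq_withDensity m lam h0 hε, integral_withDensity_eq_integral_toReal_smul
    (measurable_zeroCount.const_mul _).exp.ennreal_ofReal
    (Eventually.of_forall fun _ => ENNReal.ofReal_lt_top)]
  simp only [ENNReal.toReal_ofReal (Real.exp_pos _).le, smul_eq_mul]

lemma partition_eq_mgf {E : ℝ → ℝ} (hE : ∀ x, 0 ≤ E x) (hE_cont : Continuous E)
    (lam : Measure ℝ) [SigmaFinite lam] (h0 : lam {0} = 0) (m : ℕ) {ε : ℝ} (hε : 0 < ε) :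
    ∫ φ : Fin m → ℝ, hamWeight E (m + 1) φ ∂(Measure.pi fun _ : Fin m => siteMeasure lam ε)
      = ProbabilityTheory.mgf zeroCount (gibbsMeasure E lam m) (Real.log ε) := by
  rw [ProbabilityTheory.mgf, integral_gibbsMeasure hE hE_cont, integral_pi_siteMeasure m lam h0 hε]
  simp only [mul_comm]

theorem free_energy_convex_differentiable
    {E : ℝ → ℝ} (hE : ∀ x, 0 ≤ E x) (hE_cont : Continuous E) {M : ℝ} (hM : ∀ x, E x ≤ M)
    (hE_pos : 0 < E 0) (hE_int : Integrable E) (lam : Measure ℝ) [SigmaFinite lam]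
    (hle : lam ≤ volume) (m : ℕ) (Z : ℝ → ℝ)
    (hZ : ∀ ε, Z ε = ∫ φ : Fin m → ℝ, hamWeight E (m + 1) φ
      ∂(Measure.pi fun _ : Fin m => siteMeasure lam ε)) :
    ConvexOn ℝ Set.univ (fun t : ℝ => Real.log (Z (Real.exp t))) ∧
    (∀ t : ℝ, DifferentiableAt ℝ (fun t : ℝ => Real.log (Z (Real.exp t))) t) ∧
    ∀ ε : ℝ, 0 < ε →
      deriv (fun t : ℝ => Real.log (Z (Real.exp t))) (Real.log ε) =
        (∫ φ : Fin m → ℝ, (contact (m + 1) φ : ℝ)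
          ∂((Measure.pi fun _ => siteMeasure lam ε).withDensity
            fun φ : Fin m → ℝ => ENNReal.ofReal (hamWeight E (m + 1) φ / Z ε))) - 1 := by
  have h0 : lam {0} = 0 := le_antisymm ((hle _).trans_eq (by simp)) zero_le
  have hfin : IsFiniteMeasure (gibbsMeasure E lam m) :=
    isFiniteMeasure_withDensity (lintegral_hamWeight_lt_top hE hE_cont hM hE_int lam hle m).ne
  have hexp : ∀ t, Integrable (fun φ => Real.exp (t * zeroCount φ)) (gibbsMeasure E lam m) :=
    fun t => ProbabilityTheory.integrable_exp_mul_of_mem_Icc measurable_zeroCount.aemeasurable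
      (Eventually.of_forall zeroCount_mem_Icc)
  have hint : ∀ t, t ∈ interior
      (ProbabilityTheory.integrableExpSet zeroCount (gibbsMeasure E lam m)) := by
    intro t
    have : ProbabilityTheory.integrableExpSet zeroCount (gibbsMeasure E lam m) = univ :=
      eq_univ_of_forall hexp
    simp [this]
  have hlog : (fun t : ℝ => Real.log (Z (Real.exp t)))
      = ProbabilityTheory.cgf zeroCount (gibbsMeasure E lam m) := by
    funext t
    rw [hZ, partition_eq_mgf hE hE_cont lam h0 m (Real.exp_pos t), Real.log_exp]
    rfl
  rw [hlog]
  refine ⟨convexOn_cgf hint,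
    fun t => (ProbabilityTheory.analyticAt_cgf (hint t)).differentiableAt, fun ε hε => ?_⟩
  have hZε := (hZ ε).trans (partition_eq_mgf hE hE_cont lam h0 m hε)
  have hZpos : 0 < Z ε :=
    hZε ▸ ProbabilityTheory.mgf_pos' (gibbsMeasure_ne_zero hE_pos lam m) (hexp _)
  have hW : Measurable fun φ : Fin m → ℝ => ENNReal.ofReal (hamWeight E (m + 1) φ / Z ε) :=
    ((measurable_hamWeight hE_cont (m + 1)).div_const _).ennreal_ofReal
  have hXint : Integrable (fun φ => zeroCount φ * Real.exp (Real.log ε * zeroCount φ))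
      (gibbsMeasure E lam m) := by
    simpa using
      ProbabilityTheory.integrable_pow_mul_exp_of_mem_interior_integrableExpSet
        (hint (Real.log ε)) 1
  rw [ProbabilityTheory.deriv_cgf (hint _), ← hZε, integral_withDensity_eq_integral_toReal_smul
    hW (Eventually.of_forall fun _ => ENNReal.ofReal_lt_top), integral_pi_siteMeasure m lam h0 hε]
  have hrw : ∀ φ : Fin m → ℝ, Real.exp (Real.log ε * zeroCount φ) *
      ((ENNReal.ofReal (hamWeight E (m + 1) φ / Z ε)).toReal • (contact (m + 1) φ : ℝ))
      = hamWeight E (m + 1) φ * ((zeroCount φ * Real.exp (Real.log ε * zeroCount φ)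
        + Real.exp (Real.log ε * zeroCount φ)) / Z ε) := by
    intro φ
    rw [ENNReal.toReal_ofReal (div_nonneg (hamWeight_nonneg hE (m + 1) φ) hZpos.le),
      contact_succ, smul_eq_mul]
    ring
  simp_rw [hrw]
  rw [← integral_gibbsMeasure hE hE_cont, integral_div, integral_add hXint (hexp _), add_div]
  have : ∫ φ, Real.exp (Real.log ε * zeroCount φ) ∂(gibbsMeasure E lam m) = Z ε := hZε.symm
  rw [this, div_self hZpos.ne', add_sub_cancel_right]

/-- Convexity and derivative of the finite-volume free energy: `t ↦ log Z^a_{e^t,N}` is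
convex and differentiable on `ℝ`, with derivative at `t = log ε` equal to
`E^a_{ε,N}[ℓ_N] − 1`. -/
theorem finite_volume_free_energy_convex_differentiable
    (E : ℝ → ℝ) (σ : ℝ)
    (hE_nonneg : ∀ x, 0 ≤ E x) (hE_cont : Continuous E)
    (hE_bdd : ∃ M, ∀ x, E x ≤ M) (hE_pos : 0 < E 0)
    (hE_int : Integrable E) (hE_mass : ∫ x, E x = 1)
    (hE_mom1 : Integrable fun x => x * E x) (hE_mean : ∫ x, x * E x = 0)
    (hE_mom2 : Integrable fun x => x ^ 2 * E x) (hE_var : ∫ x, x ^ 2 * E x = σ ^ 2)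
    (hσ : 0 < σ)
 :
    ∀ N : ℕ, 1 ≤ N →
      (ConvexOn ℝ Set.univ (fun t : ℝ => Real.log (Zpin E (Real.exp t) N)) ∧
        (∀ t : ℝ, DifferentiableAt ℝ (fun t : ℝ => Real.log (Zpin E (Real.exp t) N)) t) ∧
        ∀ ε : ℝ, 0 < ε →
          deriv (fun t : ℝ => Real.log (Zpin E (Real.exp t) N)) (Real.log ε) =
            (∫ φ, (contact N φ : ℝ) ∂(Ppin E ε N)) - 1) ∧
      (ConvexOn ℝ Set.univ (fun t : ℝ => Real.log (Zwet E (Real.exp t) N)) ∧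
        (∀ t : ℝ, DifferentiableAt ℝ (fun t : ℝ => Real.log (Zwet E (Real.exp t) N)) t) ∧
        ∀ ε : ℝ, 0 < ε →
          deriv (fun t : ℝ => Real.log (Zwet E (Real.exp t) N)) (Real.log ε) =
            (∫ φ, (contact N φ : ℝ) ∂(Pwet E ε N)) - 1) := by
  rintro (_ | m) hN
  · omega
  obtain ⟨M, hM⟩ := hE_bdd
  exact ⟨free_energy_convex_differentiable hE_nonneg hE_cont hM hE_pos hE_int volume le_rfl m
      (fun ε => Zpin E ε (m + 1)) fun _ => rfl,
    free_energy_convex_differentiable hE_nonneg hE_cont hM hE_pos hE_int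
      (volume.restrict (Ici 0)) Measure.restrict_le_self m
      (fun ε => Zwet E ε (m + 1)) fun _ => rfl⟩
end
end
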